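/- Let M be a finite unitary magma. For every n ≥ 1, the number of binary trees with n leaves whose internal nodes are labeled by triples (p_0,p_1,p_2) ∈ M³ and which satisfy: (i) every internal node other than the root has p_0 = 1_M, and (ii) every internal node whose left child is internal has p_1 ≠ 1_M, equals the number of noncrossing M-cliques of arity n. -/

import Mathlib

/-! Noncrossing `M`-cliques for a unitary magma `M` (modeled as `MulOneClass`),
and the algebraic equation satisfied by their generating series. -/

/-- An arc of a polygon with `n+1` vertices (0-indexed vertices `0,…,n`),
given by a pair of vertices `x < y`.  For an `M`-clique of arity `n`,
this corresponds to the arcs `(x,y)` with `1 ≤ x < y ≤ n+1` (1-indexed). -/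
def Arc (n : ℕ) : Type := {a : Fin (n + 1) × Fin (n + 1) // a.1 < a.2}

/-- An `M`-clique of arity `n`: a labeling of all arcs by elements of `M`. -/
def CliqueLab (M : Type) (n : ℕ) : Type := Arc n → M

namespace Arc

/-- The base: the arc `(0, n)` (0-indexed), i.e. `(1, n+1)` (1-indexed). -/
def IsBase {n : ℕ} (a : Arc n) : Prop := (a.val.1 : ℕ) = 0 ∧ (a.val.2 : ℕ) = n

/-- The edges: the arcs `(i, i+1)`. -/
def IsEdge {n : ℕ} (a : Arc n) : Prop := (a.val.2 : ℕ) = (a.val.1 : ℕ) + 1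

/-- A diagonal: an arc which is neither the base nor an edge. -/
def IsDiagonal {n : ℕ} (a : Arc n) : Prop := ¬ a.IsBase ∧ ¬ a.IsEdge

/-- Two arcs cross if `x < x' < y < y'` or `x' < x < y' < y`. -/
def Cross {n : ℕ} (a b : Arc n) : Prop :=
  ((a.val.1 : ℕ) < (b.val.1 : ℕ) ∧ (b.val.1 : ℕ) < (a.val.2 : ℕ) ∧
      (a.val.2 : ℕ) < (b.val.2 : ℕ)) ∨
  ((b.val.1 : ℕ) < (a.val.1 : ℕ) ∧ (a.val.1 : ℕ) < (b.val.2 : ℕ) ∧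
      (b.val.2 : ℕ) < (a.val.2 : ℕ))

end Arc

/-- An `M`-clique is noncrossing if no two of its solid diagonals cross. -/
def Noncrossing {M : Type} [One M] {n : ℕ} (p : CliqueLab M n) : Prop :=
  ∀ a b : Arc n, a.IsDiagonal → b.IsDiagonal → p a ≠ 1 → p b ≠ 1 → ¬ a.Cross b

/-- The type of noncrossing `M`-cliques of arity `n`.  By convention there is exactly
one noncrossing `M`-clique of arity `1`: the unit clique, whose only arc is labeled
by the unit of `M`. -/
def NCClique (M : Type) [One M] (n : ℕ) : Type :=
  {p : CliqueLab M n // Noncrossing p ∧ (n = 1 → ∀ a, p a = 1)}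

/-- The number of noncrossing `M`-cliques of arity `n`. -/
noncomputable def ncCount (M : Type) [One M] (n : ℕ) : ℕ := Nat.card (NCClique M n)

/-- Binary trees with internal nodes labeled by `M³` (by triples
`(p₀,p₁,p₂)` of elements of `M`). -/
inductive BT (M : Type) : Type
  | leaf : BT M
  | node : (M × M × M) → BT M → BT M → BT M

namespace BT

/-- A tree is internal when it is a node. -/
def IsNode {M : Type} : BT M → Prop
  | leaf => False
  | node _ _ _ => True

/-- Number of leaves of a binary tree. -/
def nleaves {M : Type} : BT M → ℕ
  | leaf => 1
  | node _ l r => nleaves l + nleaves r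

/-- Condition for strict subtrees (whose roots are non-root internal nodes): the
root label has `p₀ = 1`, it has `p₁ ≠ 1` whenever the left child is internal, and
the same holds recursively below. -/
def NFSub {M : Type} [One M] : BT M → Prop
  | leaf => True
  | node p l r => p.1 = 1 ∧ (IsNode l → p.2.1 ≠ 1) ∧ NFSub l ∧ NFSub r

/-- Condition on a labeled binary tree: (i) every internal node other than the
root has `p₀ = 1`, and (ii) every internal node whose left child is internal has
`p₁ ≠ 1`. -/
def NFCond {M : Type} [One M] : BT M → Prop
  | leaf => True
  | node p l r => (IsNode l → p.2.1 ≠ 1) ∧ NFSub l ∧ NFSub r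

end BT

namespace BT

variable {M : Type}

theorem one_le_nleaves (t : BT M) : 1 ≤ t.nleaves := by
  induction t with
  | leaf => simp [nleaves]
  | node p l r ihl ihr => simp only [nleaves]; omega

theorem isNode_of_two_le_nleaves {t : BT M} (h : 2 ≤ t.nleaves) : t.IsNode := by
  cases t with
  | leaf => simp [nleaves] at h
  | node p l r => trivial

theorem two_le_nleaves_of_isNode {t : BT M} (h : t.IsNode) : 2 ≤ t.nleaves := by
  cases t with
  | leaf => exact h.elim
  | node p l r =>
    have := one_le_nleaves l
    have := one_le_nleaves r
    simp only [nleaves]; omega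

variable [One M]

/-- The labeling of arcs `(x, y)` encoded by a tree whose leftmost vertex is `o`: a node
spanning `(o, j)` and splitting at `k` labels `(o, j)`, `(o, k)`, `(k, j)` by its triple. -/
def lab : BT M → ℕ → ℕ → ℕ → M
  | leaf, _, _, _ => 1
  | node p l r, o, x, y =>
    if x = o ∧ y = o + l.nleaves + r.nleaves then p.1
    else if x = o ∧ y = o + l.nleaves then p.2.1
    else if x = o + l.nleaves ∧ y = o + l.nleaves + r.nleaves then p.2.2
    else if y ≤ o + l.nleaves then lab l o x y
    else lab r (o + l.nleaves) x y

theorem lab_support (t : BT M) (o x y : ℕ) (h : lab t o x y ≠ 1) :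
    o ≤ x ∧ x < y ∧ y ≤ o + t.nleaves := by
  induction t generalizing o with
  | leaf => simp [lab] at h
  | node p l r ihl ihr =>
    have := one_le_nleaves l
    have := one_le_nleaves r
    have ihl := ihl o
    have ihr := ihr (o + l.nleaves)
    simp only [lab] at h
    simp only [nleaves]
    split_ifs at h <;> first | omega | (have := ihl h; omega) | (have := ihr h; omega)

theorem lab_node_base (p : M × M × M) (l r : BT M) (o : ℕ) :
    lab (node p l r) o o (o + l.nleaves + r.nleaves) = p.1 := by
  simp [lab]

theorem lab_node_left (p : M × M × M) (l r : BT M) (o : ℕ) :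
    lab (node p l r) o o (o + l.nleaves) = p.2.1 := by
  have := one_le_nleaves r
  rw [lab, if_neg (by omega), if_pos (by omega)]

theorem lab_node_right (p : M × M × M) (l r : BT M) (o : ℕ) :
    lab (node p l r) o (o + l.nleaves) (o + l.nleaves + r.nleaves) = p.2.2 := by
  have := one_le_nleaves l
  rw [lab, if_neg (by omega), if_neg (by omega), if_pos (by omega)]

/-- Arcs leaving the leftmost vertex and ending strictly between the splitting vertex and the
last vertex are not solid. -/
theorem lab_node_eq_one (p : M × M × M) (l r : BT M) (o y : ℕ) (h₁ : o + l.nleaves < y)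
    (h₂ : y < o + l.nleaves + r.nleaves) : lab (node p l r) o o y = 1 := by
  have := one_le_nleaves l
  rw [lab, if_neg (by omega), if_neg (by omega), if_neg (by omega), if_neg (by omega)]
  by_contra h
  have := lab_support _ _ _ _ h
  omega

theorem nfSub_iff (t : BT M) (o : ℕ) :
    NFSub t ↔ NFCond t ∧ lab t o o (o + t.nleaves) = 1 := by
  cases t with
  | leaf => simp [NFSub, NFCond, lab]
  | node p l r =>
    simp only [nleaves, NFSub, NFCond, ← add_assoc, lab_node_base]
    tauto

theorem lab_left_eq (p : M × M × M) (l r : BT M) (o x y : ℕ) (hl : NFSub l) :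
    lab l o x y = if y ≤ o + l.nleaves ∧ ¬ (x = o ∧ y = o + l.nleaves)
      then lab (node p l r) o x y else 1 := by
  have := one_le_nleaves l
  have := one_le_nleaves r
  split_ifs with h
  · rw [lab, if_neg (by omega), if_neg (by omega), if_neg (by omega), if_pos (by omega)]
  · by_contra hne
    have := lab_support _ _ _ _ hne
    obtain ⟨rfl, rfl⟩ : x = o ∧ y = o + l.nleaves := by omega
    exact hne ((nfSub_iff l x).1 hl).2

theorem lab_right_eq (p : M × M × M) (l r : BT M) (o x y : ℕ) (hr : NFSub r) :
    lab r (o + l.nleaves) x y =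
      if o + l.nleaves ≤ x ∧ x < y ∧ ¬ (x = o + l.nleaves ∧ y = o + l.nleaves + r.nleaves)
      then lab (node p l r) o x y else 1 := by
  have := one_le_nleaves l
  have := one_le_nleaves r
  split_ifs with h
  · rw [lab, if_neg (by omega), if_neg (by omega), if_neg (by omega), if_neg (by omega)]
  · by_contra hne
    have := lab_support _ _ _ _ hne
    obtain ⟨rfl, rfl⟩ : x = o + l.nleaves ∧ y = o + l.nleaves + r.nleaves := by omega
    exact hne ((nfSub_iff r _).1 hr).2

/-- The splitting vertex is determined by the labeling. -/
theorem nleaves_left_le {p p' : M × M × M} {l r l' r' : BT M} {o : ℕ}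
    (hn : l.nleaves + r.nleaves = l'.nleaves + r'.nleaves)
    (h' : NFCond (node p' l' r'))
    (h : lab (node p l r) o = lab (node p' l' r') o) : l'.nleaves ≤ l.nleaves := by
  by_contra! hlt
  have := one_le_nleaves l
  have := one_le_nleaves r'
  apply h'.1 (isNode_of_two_le_nleaves (by omega))
  rw [← lab_node_left p' l' r' o, ← h]
  exact lab_node_eq_one _ _ _ _ _ (by omega) (by omega)

theorem lab_injective {t t' : BT M} {o : ℕ} (ht : NFCond t) (ht' : NFCond t')
    (hn : t.nleaves = t'.nleaves) (h : lab t o = lab t' o) : t = t' := by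
  induction t generalizing t' o with
  | leaf =>
    cases t' with
    | leaf => rfl
    | node p l r =>
      have := two_le_nleaves_of_isNode (t := node p l r) trivial
      simp only [nleaves] at *
      omega
  | node p l r ihl ihr =>
    cases t' with
    | leaf =>
      have := two_le_nleaves_of_isNode (t := node p l r) trivial
      simp only [nleaves] at *
      omega
    | node p' l' r' =>
      have hn : l.nleaves + r.nleaves = l'.nleaves + r'.nleaves := hn
      have hl : l.nleaves = l'.nleaves :=
        le_antisymm (nleaves_left_le hn.symm ht h.symm) (nleaves_left_le hn ht' h)
      have hr : r.nleaves = r'.nleaves := by omega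
      have h₀ : p.1 = p'.1 := by
        rw [← lab_node_base p l r o, h, hl, hr, lab_node_base]
      have h₁ : p.2.1 = p'.2.1 := by
        rw [← lab_node_left p l r o, h, hl, lab_node_left]
      have h₂ : p.2.2 = p'.2.2 := by
        rw [← lab_node_right p l r o, h, hl, hr, lab_node_right]
      have hp : p = p' := Prod.ext h₀ (Prod.ext h₁ h₂)
      have hll : l = l' := by
        refine ihl (o := o) ((nfSub_iff l o).1 ht.2.1).1 ((nfSub_iff l' o).1 ht'.2.1).1 hl ?_
        funext x y
        rw [lab_left_eq p l r o x y ht.2.1, lab_left_eq p' l' r' o x y ht'.2.1, h, hl]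
      have hrr : r = r' := by
        refine ihr (o := o + l.nleaves) ((nfSub_iff r o).1 ht.2.2).1
          ((nfSub_iff r' o).1 ht'.2.2).1 hr ?_
        funext x y
        rw [lab_right_eq p l r o x y ht.2.2, hl, lab_right_eq p' l' r' o x y ht'.2.2, h, hr]
      rw [hp, hll, hrr]

theorem lab_noncrossing (t : BT M) (o x y x' y' : ℕ) (h₁ : x < x') (h₂ : x' < y) (h₃ : y < y')
    (h : lab t o x y ≠ 1) : lab t o x' y' = 1 := by
  by_contra h'
  induction t generalizing o with
  | leaf => simp [lab] at h
  | node p l r ihl ihr =>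
    have := lab_support _ _ _ _ h
    have := lab_support _ _ _ _ h'
    have sr := lab_support r (o + l.nleaves) x y
    have sr' := lab_support r (o + l.nleaves) x' y'
    have ihl := ihl o
    have ihr := ihr (o + l.nleaves)
    simp only [nleaves] at *
    simp only [lab] at h h'
    split_ifs at h h' <;> first
      | omega
      | exact ihl h h'
      | exact ihr h h'
      | (have := sr h; omega)
      | (have := sr' h'; omega)

theorem exists_lab_eq (n : ℕ) (hn : 1 ≤ n) (o : ℕ) (f : ℕ → ℕ → M)
    (hsupp : ∀ x y, f x y ≠ 1 → o ≤ x ∧ x < y ∧ y ≤ o + n)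
    (hnc : ∀ x y x' y', x < x' → x' < y → y < y' → f x y ≠ 1 → f x' y' = 1)
    (hone : n = 1 → ∀ x y, f x y = 1) :
    ∃ t : BT M, t.nleaves = n ∧ NFCond t ∧ lab t o = f := by
  classical
  induction n using Nat.strong_induction_on generalizing o f with
  | _ n ih =>
  rcases Nat.eq_or_lt_of_le hn with rfl | hn2
  · exact ⟨leaf, rfl, trivial, by funext x y; simp [lab, hone rfl]⟩
  obtain ⟨a, ha₁, han, hsolid, hmax⟩ : ∃ a, 1 ≤ a ∧ a < n ∧ (1 < a → f o (o + a) ≠ 1) ∧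
      ∀ b, a < b → b < n → f o (o + b) = 1 := by
    let P : ℕ → Prop := fun a => a = 1 ∨ f o (o + a) ≠ 1
    have hP1 : P 1 := Or.inl rfl
    refine ⟨Nat.findGreatest P (n - 1), Nat.le_findGreatest (by omega) hP1, ?_, ?_, ?_⟩
    · have := Nat.findGreatest_le (P := P) (n - 1)
      omega
    · intro h
      rcases Nat.findGreatest_spec (P := P) (n := n - 1) (by omega) hP1 with h' | h'
      · omega
      · exact h'
    · intro b hb hbn
      have := Nat.findGreatest_is_greatest (P := P) hb (by omega)
      by_contra hne
      exact this (Or.inr hne)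
  have hnc' : ∀ (c : ℕ → ℕ → Prop) [∀ x y, Decidable (c x y)] (x y x' y' : ℕ), x < x' → x' < y →
      y < y' → (if c x y then f x y else 1) ≠ 1 → (if c x' y' then f x' y' else 1) = 1 := by
    intro c _ x y x' y' h₁ h₂ h₃ h
    split_ifs at h with hc
    · exact ite_eq_right_iff.2 fun _ => hnc x y x' y' h₁ h₂ h₃ h
    · exact (h rfl).elim
  obtain ⟨l, hl, hlc, hlf⟩ := ih a han ha₁ o
    (fun x y => if y ≤ o + a ∧ ¬ (x = o ∧ y = o + a) then f x y else 1)
    (by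
      intro x y h
      split_ifs at h with hc
      · have := hsupp x y h; omega
      · exact (h rfl).elim)
    (hnc' (fun x y => y ≤ o + a ∧ ¬ (x = o ∧ y = o + a)))
    (by
      intro ha x y
      split_ifs with hc
      · by_contra h
        have := hsupp x y h; omega
      · rfl)
  obtain ⟨r, hr, hrc, hrf⟩ := ih (n - a) (by omega) (by omega) (o + a)
    (fun x y => if o + a ≤ x ∧ ¬ (x = o + a ∧ y = o + n) then f x y else 1)
    (by
      intro x y h
      split_ifs at h with hc
      · have := hsupp x y h; omega
      · exact (h rfl).elim)
    (hnc' (fun x y => o + a ≤ x ∧ ¬ (x = o + a ∧ y = o + n)))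
    (by
      intro ha x y
      split_ifs with hc
      · by_contra h
        have := hsupp x y h; omega
      · rfl)
  refine ⟨node (f o (o + n), f o (o + a), f (o + a) (o + n)) l r, ?_, ⟨?_, ?_, ?_⟩, ?_⟩
  · simp only [nleaves]; omega
  · intro h
    have := two_le_nleaves_of_isNode h
    exact hsolid (by omega)
  · refine (nfSub_iff l o).2 ⟨hlc, ?_⟩
    rw [hlf, hl]; simp
  · refine (nfSub_iff r (o + a)).2 ⟨hrc, ?_⟩
    rw [hrf, hr, show o + a + (n - a) = o + n by omega]; simp
  · funext x y
    simp only [lab]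
    rw [hl, hr, hlf, hrf, show o + a + (n - a) = o + n by omega]
    split_ifs with c₁ c₂ c₃ c₄
    · rw [c₁.1, c₁.2]
    · rw [c₂.1, c₂.2]
    · rw [c₃.1, c₃.2]
    · exact if_pos ⟨c₄, c₂⟩
    · refine ite_eq_left_iff.2 fun c₅ => ?_
      by_contra h
      have := hsupp x y (Ne.symm h)
      rcases Nat.lt_or_ge o x with hx | hx
      · exact h (hnc o (o + a) x y hx (by omega) (by omega) (hsolid (by omega))).symm
      · obtain rfl : x = o := by omega
        apply h
        rw [show y = x + (y - x) by omega, hmax (y - x) (by omega) (by omega)]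

end BT

/-- Extension of a clique by the unit to all pairs of natural numbers. -/
noncomputable def CliqueLab.extend {M : Type} [One M] {n : ℕ} (p : CliqueLab M n) (x y : ℕ) : M :=
  if h : x < y ∧ y ≤ n then p ⟨(⟨x, by omega⟩, ⟨y, by omega⟩), h.1⟩ else 1

theorem CliqueLab.extend_arc {M : Type} [One M] {n : ℕ} (p : CliqueLab M n) (a : Arc n) :
    p.extend a.val.1 a.val.2 = p a := by
  have := a.val.2.isLt
  rw [extend, dif_pos ⟨a.2, by omega⟩]
  rfl

/-- The noncrossing clique encoded by a tree. -/
def BT.toNCClique {M : Type} [One M] {n : ℕ}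
    (t : {t : BT M // BT.nleaves t = n ∧ BT.NFCond t}) : NCClique M n :=
  ⟨fun a => t.1.lab 0 a.val.1 a.val.2, by
    refine ⟨fun a b _ _ ha hb hc => ?_, ?_⟩
    · rcases hc with ⟨h₁, h₂, h₃⟩ | ⟨h₁, h₂, h₃⟩
      · exact hb (t.1.lab_noncrossing 0 _ _ _ _ h₁ h₂ h₃ ha)
      · exact ha (t.1.lab_noncrossing 0 _ _ _ _ h₁ h₂ h₃ hb)
    · rintro rfl a
      obtain ⟨t, ht, -⟩ := t
      cases t with
      | leaf => rfl
      | node p l r =>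
        have := BT.two_le_nleaves_of_isNode (t := BT.node p l r) trivial
        omega⟩

theorem BT.toNCClique_bijective {M : Type} [One M] {n : ℕ} (hn : 1 ≤ n) :
    Function.Bijective (BT.toNCClique (M := M) (n := n)) := by
  constructor
  · rintro ⟨t, ht, htc⟩ ⟨t', ht', htc'⟩ h
    refine Subtype.ext (BT.lab_injective (o := 0) htc htc' (ht.trans ht'.symm) ?_)
    funext x y
    by_cases hxy : x < y ∧ y ≤ n
    · exact congrFun (congrArg Subtype.val h) ⟨(⟨x, by omega⟩, ⟨y, by omega⟩), hxy.1⟩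
    · trans 1
      · by_contra hne
        have := t.lab_support 0 x y hne
        omega
      · by_contra hne
        have := t'.lab_support 0 x y (Ne.symm hne)
        omega
  · rintro ⟨p, hp, hp1⟩
    have hsupp : ∀ x y, CliqueLab.extend p x y ≠ 1 → x < y ∧ y ≤ n := by
      intro x y h
      by_contra hxy
      exact h (dif_neg hxy)
    obtain ⟨t, ht, htc, hlab⟩ := BT.exists_lab_eq n hn 0 p.extend
      (fun x y h => by have := hsupp x y h; omega)
      (by
        intro x y x' y' h₁ h₂ h₃ h
        by_contra h'
        have hs := hsupp x y h
        have hs' := hsupp x' y' h'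
        let a : Arc n := ⟨(⟨x, by omega⟩, ⟨y, by omega⟩), hs.1⟩
        let b : Arc n := ⟨(⟨x', by omega⟩, ⟨y', by omega⟩), hs'.1⟩
        have ha : a.IsDiagonal := by
          simp only [Arc.IsDiagonal, Arc.IsBase, Arc.IsEdge, a]; omega
        have hb : b.IsDiagonal := by
          simp only [Arc.IsDiagonal, Arc.IsBase, Arc.IsEdge, b]; omega
        refine hp a b ha hb ?_ ?_ (Or.inl ⟨h₁, h₂, h₃⟩)
        · rwa [← CliqueLab.extend_arc p a]
        · rwa [← CliqueLab.extend_arc p b])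
      (by
        intro h1 x y
        rw [CliqueLab.extend]
        split_ifs with h
        · exact hp1 h1 _
        · rfl)
    refine ⟨⟨t, ht, htc⟩, Subtype.ext ?_⟩
    funext a
    change t.lab 0 a.val.1 a.val.2 = p a
    rw [hlab, CliqueLab.extend_arc]

/-- For every `n ≥ 1`, the number of labeled binary trees with `n` leaves
satisfying conditions (i) and (ii) equals the number of noncrossing `M`-cliques
of arity `n`. -/
theorem statement9 (M : Type) [MulOneClass M] [Fintype M] (n : ℕ) (hn : 1 ≤ n) :
    Nat.card {t : BT M // BT.nleaves t = n ∧ BT.NFCond t} = ncCount M n :=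
  Nat.card_eq_of_bijective _ (BT.toNCClique_bijective hn)
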